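/- Let M be a module over a commutative ring and θ an endomorphism of M with θ^n = 0 and θ^{n−1} ≠ 0. Then for every l with 1 ≤ l ≤ n−1, the map induced by θ from C^l(M)/C^{l−1}(M) to C^{l−2}(M)/C^{l−3}(M) is injective. -/

import Mathlib

/-- For a nilpotent endomorphism `θ` with `θ^n = 0`, the canonical filtration
`C^l(M) = Σ_{i-j = l, 0 ≤ i ≤ n, 1 ≤ j ≤ n+1} ker(θ^i) ∩ im(θ^{j-1})`. -/
def Cfilt {R M : Type*} [CommRing R] [AddCommGroup M] [Module R M]
    (θ : M →ₗ[R] M) (n : ℕ) (l : ℤ) : Submodule R M :=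
  ⨆ (p : ℕ × ℕ) (_ : (p.1 : ℤ) - (p.2 : ℤ) = l ∧ p.1 ≤ n ∧ 1 ≤ p.2 ∧ p.2 ≤ n + 1),
    LinearMap.ker (θ ^ p.1) ⊓ LinearMap.range (θ ^ (p.2 - 1))

section CanonicalFiltration

variable {R M : Type*} [CommRing R] [AddCommGroup M] [Module R M]

/-- An element of `ker (θ ^ i) ∩ im (θ ^ a)` lies in `C^{i - a - 1}`. -/
theorem mem_Cfilt_of_pow_eq_zero (θ : M →ₗ[R] M) {n i a : ℕ} {l : ℤ} (hl : (i : ℤ) - (a + 1) = l)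
    (hi : i ≤ n) (ha : a ≤ n) {x : M} (hx : (θ ^ i) x = 0) (m : M) (hm : (θ ^ a) m = x) :
    x ∈ Cfilt θ n l := by
  refine Submodule.mem_iSup_of_mem (i, a + 1) (Submodule.mem_iSup_of_mem ?_ ?_)
  · refine ⟨?_, hi, ?_, ?_⟩
    · push_cast; exact hl
    · simp
    · simpa using ha
  · exact ⟨hx, m, by simpa using hm⟩

/-- To bound `C^l` it suffices to bound each of the intersections `ker (θ ^ i) ∩ im (θ ^ a)`. -/
theorem Cfilt_le (θ : M →ₗ[R] M) {n : ℕ} {l : ℤ} {N : Submodule R M}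
    (h : ∀ i a : ℕ, (i : ℤ) - (a + 1) = l → i ≤ n → a ≤ n →
      ∀ m, (θ ^ i) ((θ ^ a) m) = 0 → (θ ^ a) m ∈ N) :
    Cfilt θ n l ≤ N := by
  refine iSup₂_le ?_
  rintro ⟨i, j⟩ ⟨hl, hi, hj, hjn⟩ x ⟨hx, m, rfl⟩
  dsimp only at *
  exact h i (j - 1) (by omega) hi (by omega) m hx

/-- For `l ≥ 0`, the endomorphism maps `C^l` into `C^{l-2}`. -/
theorem map_Cfilt_le (θ : M →ₗ[R] M) {n : ℕ} {l : ℤ} (hl : 0 ≤ l) :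
    Submodule.map θ (Cfilt θ n l) ≤ Cfilt θ n (l - 2) := by
  rw [Submodule.map_le_iff_le_comap]
  refine Cfilt_le θ fun i a hia hi ha m hm => ?_
  obtain ⟨k, rfl⟩ : ∃ k, i = k + 1 := ⟨i - 1, by omega⟩
  refine mem_Cfilt_of_pow_eq_zero θ (i := k) (a := a + 1) (by push_cast at *; omega)
    (by omega) (by omega) ?_ m ?_
  · rwa [pow_succ, Module.End.mul_apply] at hm
  · rw [pow_succ', Module.End.mul_apply]

/-- Up to `ker (θ ^ (l - 1))`, every element of `C^{l-3}` is the image of an element of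
`C^{l-1}`. -/
theorem Cfilt_le_map_sup_ker (θ : M →ₗ[R] M) {n l : ℕ} (hnil : θ ^ n = 0) (hln : l ≤ n) :
    Cfilt θ n ((l : ℤ) - 3) ≤
      Submodule.map θ (Cfilt θ n ((l : ℤ) - 1)) ⊔ LinearMap.ker (θ ^ (l - 1)) := by
  refine Cfilt_le θ fun i a hia hi ha m hm => ?_
  rcases a with _ | a
  · refine Submodule.mem_sup_right ?_
    exact LinearMap.mem_ker.2 (Module.End.pow_map_zero_of_le (by push_cast at hia; omega) hm)
  · refine Submodule.mem_sup_left ⟨(θ ^ a) m, ?_, by rw [pow_succ', Module.End.mul_apply]⟩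
    rcases hi.lt_or_eq with hi | rfl
    · refine mem_Cfilt_of_pow_eq_zero θ (i := i + 1) (a := a) (by push_cast at *; omega)
        hi (by omega) ?_ m rfl
      rwa [pow_succ, Module.End.mul_apply, ← Module.End.mul_apply θ, ← pow_succ']
    · obtain ⟨b, rfl⟩ : ∃ b, a = b + 1 := ⟨a - 1, by push_cast at hia; omega⟩
      refine mem_Cfilt_of_pow_eq_zero θ (i := i) (a := b) (by push_cast at *; omega)
        le_rfl (by omega) ?_ (θ m) ?_
      · rw [hnil, LinearMap.zero_apply]
      · rw [pow_succ, Module.End.mul_apply]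

/-- For `1 ≤ l ≤ n`, the preimage of `C^{l-3}` under the endomorphism is contained in
`C^{l-1}`. -/
theorem comap_Cfilt_le (θ : M →ₗ[R] M) {n l : ℕ} (hnil : θ ^ n = 0) (hl : 1 ≤ l) (hln : l ≤ n) :
    Submodule.comap θ (Cfilt θ n ((l : ℤ) - 3)) ≤ Cfilt θ n ((l : ℤ) - 1) := by
  intro x hx
  obtain ⟨_, ⟨w, hw, rfl⟩, y, hy, hwy⟩ :=
    Submodule.mem_sup.1 (Cfilt_le_map_sup_ker θ hnil hln hx)
  have hxw : θ (x - w) = y := by rw [map_sub, ← hwy, add_sub_cancel_left]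
  have hmem : x - w ∈ Cfilt θ n ((l : ℤ) - 1) := by
    refine mem_Cfilt_of_pow_eq_zero θ (i := l) (a := 0) (by simp) hln (by omega) ?_ (x - w) rfl
    rw [← Nat.sub_add_cancel hl, pow_succ, Module.End.mul_apply, hxw]
    exact hy
  simpa using Submodule.add_mem _ hmem hw

end CanonicalFiltration

/-- Let `θ` be an endomorphism of a module `M` over a commutative ring, with `θ^n = 0`
and `θ^{n-1} ≠ 0`.  Then for every `1 ≤ l ≤ n-1` the map induced by `θ` from
`C^l/C^{l-1}` to `C^{l-2}/C^{l-3}` is (well defined and) injective. -/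
theorem stmt_7 {R M : Type*} [CommRing R] [AddCommGroup M] [Module R M]
    (θ : M →ₗ[R] M) (n : ℕ)
    (hnil : θ ^ n = 0) (hnil' : θ ^ (n - 1) ≠ 0) :
    ∀ l : ℕ, 1 ≤ l → (l : ℤ) ≤ (n : ℤ) - 1 →
      -- θ maps C^l into C^{l-2} and C^{l-1} into C^{l-3}, so the induced map
      -- C^l/C^{l-1} → C^{l-2}/C^{l-3} is well defined ...
      (Submodule.map θ (Cfilt θ n (l : ℤ)) ≤ Cfilt θ n ((l : ℤ) - 2)) ∧
      (Submodule.map θ (Cfilt θ n ((l : ℤ) - 1)) ≤ Cfilt θ n ((l : ℤ) - 3)) ∧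
      -- ... and injective
      (∀ x ∈ Cfilt θ n (l : ℤ),
        θ x ∈ Cfilt θ n ((l : ℤ) - 3) → x ∈ Cfilt θ n ((l : ℤ) - 1)) := by
  intro l hl hln
  refine ⟨map_Cfilt_le θ (by omega), ?_, fun x _ hx => comap_Cfilt_le θ hnil hl (by omega) hx⟩
  have h := map_Cfilt_le θ (n := n) (l := (l : ℤ) - 1) (by omega)
  rwa [show (l : ℤ) - 1 - 2 = l - 3 by ring] at h
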